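/- Let a, b be odd positive integers, R = (b^a), and let λ ⊆ R be almost self-complementary. Then there exists a partition π (a witness) such that for every partition μ ⊆ R, the Littlewood–Richardson coefficient c^π_{μ, μ^c} is nonzero if and only if μ = λ or μ = λ^c. -/

import Mathlib

open scoped Classical

/-!  Common definitions: the ring `Λ` of symmetric functions is realized inside the ring
`MvPowerSeries ℕ ℚ` of formal power series in countably many variables `x₀, x₁, x₂, …`
with rational coefficients; Schur functions are defined by their monomial expansion over
semistandard Young tableaux, and Littlewood–Richardson coefficients are defined as the
number of Littlewood–Richardson fillings (semistandard skew fillings whose reverse reading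
word is a lattice word), which is the coefficient of `s_ν` in `s_lam ⬝ s_μ`. -/

/-- The Schur function `s_μ` of a Young diagram `μ`: the coefficient of the monomial `x^m`
is the number of semistandard Young tableaux of shape `μ` with weight `m`. -/
noncomputable def schur (μ : YoungDiagram) : MvPowerSeries ℕ ℚ :=
  fun m : ℕ →₀ ℕ =>
    (Set.ncard {T : SemistandardYoungTableau μ |
        ∀ k : ℕ, (μ.cells.filter fun c => T c.1 c.2 = k).card = m k} : ℚ)

/-- A Littlewood–Richardson filling of the skew shape `ν/lam` with content `μ`:
a filling of the cells of `ν` not in `lam` with entries `0, 1, 2, …` that is weakly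
increasing along rows, strictly increasing down columns, in which the entry `k` occurs
`μ.rowLen k` times, and such that reading right-to-left along rows, top to bottom, every
initial segment contains at least as many `k`'s as `(k+1)`'s (the lattice word condition). -/
structure LRFilling (ν lam μ : YoungDiagram) : Type where
  le : lam ≤ ν
  entry : ℕ → ℕ → ℕ
  zeros : ∀ i j, (i, j) ∉ ν.cells \ lam.cells → entry i j = 0
  row_weak : ∀ i j, (i, j) ∈ ν.cells \ lam.cells → (i, j + 1) ∈ ν.cells \ lam.cells →
    entry i j ≤ entry i (j + 1)
  col_strict : ∀ i j, (i, j) ∈ ν.cells \ lam.cells → (i + 1, j) ∈ ν.cells \ lam.cells →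
    entry i j < entry (i + 1) j
  content : ∀ k, ((ν.cells \ lam.cells).filter fun c => entry c.1 c.2 = k).card = μ.rowLen k
  lattice : ∀ i j k,
    ((ν.cells \ lam.cells).filter fun c =>
        (c.1 < i ∨ (c.1 = i ∧ j ≤ c.2)) ∧ entry c.1 c.2 = k + 1).card ≤
    ((ν.cells \ lam.cells).filter fun c =>
        (c.1 < i ∨ (c.1 = i ∧ j ≤ c.2)) ∧ entry c.1 c.2 = k).card

/-- The Littlewood–Richardson coefficient `c^ν_{lam,μ}`, i.e. the coefficient of the
Schur function `s_ν` in the product `s_lam ⬝ s_μ`. -/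
noncomputable def lrCoeff (ν lam μ : YoungDiagram) : ℕ :=
  Nat.card (LRFilling ν lam μ)

/-- The `a × b` rectangular Young diagram `R = (b^a)`. -/
def rect (a b : ℕ) : YoungDiagram :=
  ⟨Finset.range a ×ˢ Finset.range b, by
    rintro ⟨i, j⟩ ⟨i', j'⟩ ⟨hi, hj⟩ h
    simp only [Finset.coe_product, Finset.coe_range, Set.mem_prod, Set.mem_Iio] at h ⊢
    exact ⟨lt_of_le_of_lt hi h.1, lt_of_le_of_lt hj h.2⟩⟩

/-- The complement `μᶜ` of `μ` in the `a × b` rectangle: the boxes of the rectangle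
not in `μ`, rotated by 180°; its parts are `(μᶜ)ᵢ = b - μ_{a+1-i}` for `1 ≤ i ≤ a`. -/
def rectCompl (a b : ℕ) (μ : YoungDiagram) : YoungDiagram :=
  ⟨(rect a b).cells.filter fun c => (a - 1 - c.1, b - 1 - c.2) ∉ μ, by
    rintro ⟨i, j⟩ ⟨i', j'⟩ ⟨hi, hj⟩ h
    simp only [Finset.coe_filter, Set.mem_setOf_eq] at h ⊢
    refine ⟨(rect a b).isLowerSet ⟨hi, hj⟩ h.1, fun hmem => h.2 ?_⟩
    exact μ.isLowerSet ⟨Nat.sub_le_sub_left hi _, Nat.sub_le_sub_left hj _⟩ hmem⟩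

/-- Greedy `w`-decomposition piece sizes, starting from the state where `r` horizontal and
`c` vertical pieces have already been taken.  The letter `true` stands for `h` (a horizontal
piece: the rest of row `r`), `false` for `v` (a vertical piece: the rest of column `c`). -/
def wPieces : List Bool → ℕ → ℕ → YoungDiagram → List ℕ
  | [], _, _, _ => []
  | true :: w, r, c, lam => (lam.rowLen r - c) :: wPieces w (r + 1) c lam
  | false :: w, r, c, lam => (lam.colLen c - r) :: wPieces w r (c + 1) lam

/-- The `w`-notation `lam^w` of a partition `lam`: the list of piece sizes of its greedy
`w`-decomposition. -/
def wNotation (w : List Bool) (lam : YoungDiagram) : List ℕ :=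
  wPieces w 0 0 lam

/-- `lexLE l₁ l₂` : `l₁ ≤ l₂` in lexicographic order. -/
def lexLE (l₁ l₂ : List ℕ) : Prop :=
  l₁ = l₂ ∨ List.Lex (· < ·) l₁ l₂

/-- Remove the first row of a Young diagram. -/
def stripRow (lam : YoungDiagram) : YoungDiagram :=
  ⟨(lam.cells.filter fun c => 0 < c.1).image fun c => (c.1 - 1, c.2), by
    rintro ⟨i', j'⟩ ⟨i, j⟩ ⟨hi, hj⟩ h
    simp only [Finset.coe_image, Finset.coe_filter, Set.mem_image, Set.mem_setOf_eq,
      Prod.exists] at h ⊢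
    obtain ⟨x, y, ⟨hxy, hx⟩, heq⟩ := h
    obtain ⟨hx1, rfl⟩ : x - 1 = i' ∧ y = j' := by simpa [Prod.ext_iff] using heq
    exact ⟨i + 1, j, ⟨lam.isLowerSet (b := (i + 1, j)) ⟨by omega, by simpa using hj⟩ hxy,
      by omega⟩, by simp⟩⟩

/-- Remove the first column of a Young diagram. -/
def stripCol (lam : YoungDiagram) : YoungDiagram :=
  (stripRow lam.transpose).transpose

/-- For `a`, `b` both odd, `lam` is almost self-complementary in the `a × b` rectangle if
`lam` is contained in the rectangle and the diagrams of `lam` and of its complement differ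
only in which one contains the central box (row `(a+1)/2`, column `(b+1)/2`, 1-indexed). -/
def AlmostSelfCompl (a b : ℕ) (lam : YoungDiagram) : Prop :=
  lam ≤ rect a b ∧
    lam.cells \ (rectCompl a b lam).cells ∪ (rectCompl a b lam).cells \ lam.cells =
      {((a - 1) / 2, (b - 1) / 2)}

/-! ### Membership lemmas -/

theorem mem_rect' {a b i j : ℕ} : (i, j) ∈ rect a b ↔ i < a ∧ j < b := by
  rw [← YoungDiagram.mem_cells]
  simp [rect]

theorem mem_rectCompl' {a b i j : ℕ} {μ : YoungDiagram} :
    (i, j) ∈ rectCompl a b μ ↔ (i < a ∧ j < b) ∧ (a - 1 - i, b - 1 - j) ∉ μ := by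
  rw [← YoungDiagram.mem_cells]
  simp [rectCompl, mem_rect']

theorem mem_stripRow' {i j : ℕ} {μ : YoungDiagram} :
    (i, j) ∈ stripRow μ ↔ (i + 1, j) ∈ μ := by
  rw [← YoungDiagram.mem_cells]
  simp only [stripRow, Finset.mem_image, Finset.mem_filter, Prod.exists, Prod.mk.injEq,
    YoungDiagram.mem_cells]
  constructor
  · rintro ⟨x, y, ⟨h, hx⟩, h1, rfl⟩
    have : i + 1 = x := by omega
    rwa [this]
  · intro h
    exact ⟨i + 1, j, ⟨h, by omega⟩, by omega, rfl⟩

theorem mem_stripCol' {i j : ℕ} {μ : YoungDiagram} :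
    (i, j) ∈ stripCol μ ↔ (i, j + 1) ∈ μ := by
  unfold stripCol
  rw [YoungDiagram.mem_transpose]
  simp only [Prod.swap_prod_mk]
  rw [mem_stripRow', YoungDiagram.mem_transpose]
  rfl

theorem mem_down {μ : YoungDiagram} {i j i' j' : ℕ} (h : (i, j) ∈ μ) (hi : i' ≤ i)
    (hj : j' ≤ j) : (i', j') ∈ μ := μ.up_left_mem hi hj h

theorem yd_ext {μ ν : YoungDiagram} (h : ∀ i j, (i, j) ∈ μ ↔ (i, j) ∈ ν) : μ = ν := by
  ext ⟨i, j⟩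
  simpa using h i j

theorem yd_le {μ ν : YoungDiagram} : μ ≤ ν ↔ ∀ i j, (i, j) ∈ μ → (i, j) ∈ ν := by
  constructor
  · intro h i j hm
    exact h hm
  · rintro h ⟨i, j⟩ hm
    exact h i j hm

theorem rowLen_stripRow (μ : YoungDiagram) (k : ℕ) :
    (stripRow μ).rowLen k = μ.rowLen (k + 1) := by
  apply eq_of_forall_lt_iff
  intro c
  rw [← YoungDiagram.mem_iff_lt_rowLen, ← YoungDiagram.mem_iff_lt_rowLen, mem_stripRow']

theorem rowLen_stripCol (μ : YoungDiagram) (k : ℕ) :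
    (stripCol μ).rowLen k = μ.rowLen k - 1 := by
  apply eq_of_forall_lt_iff
  intro c
  rw [← YoungDiagram.mem_iff_lt_rowLen, mem_stripCol', YoungDiagram.mem_iff_lt_rowLen]
  omega

/-- membership in a skew shape -/
theorem mem_skew {ν lam : YoungDiagram} {i j : ℕ} :
    (i, j) ∈ ν.cells \ lam.cells ↔ (i, j) ∈ ν ∧ (i, j) ∉ lam := by
  simp

/-! ### Basic facts on Littlewood–Richardson fillings -/

namespace LRFilling

variable {π μ ν : YoungDiagram}

theorem row_mono (T : LRFilling π μ ν) {i j j' : ℕ} (h : (i, j) ∈ π.cells \ μ.cells)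
    (h' : (i, j') ∈ π.cells \ μ.cells) (hj : j ≤ j') : T.entry i j ≤ T.entry i j' := by
  induction j', hj using Nat.le_induction with
  | base => exact le_rfl
  | succ n hn ih =>
    rw [mem_skew] at h h'
    have hm : (i, n) ∈ π.cells \ μ.cells :=
      mem_skew.2 ⟨mem_down h'.1 le_rfl (by omega), fun hh => h.2 (mem_down hh le_rfl hn)⟩
    exact (ih hm).trans (T.row_weak i n hm (mem_skew.2 h'))

theorem col_mono (T : LRFilling π μ ν) {i j d : ℕ} (h : (i, j) ∈ π.cells \ μ.cells)
    (h' : (i + d, j) ∈ π.cells \ μ.cells) : T.entry i j + d ≤ T.entry (i + d) j := by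
  induction d with
  | zero => simp
  | succ n ih =>
    rw [mem_skew] at h h'
    have hm : (i + n, j) ∈ π.cells \ μ.cells :=
      mem_skew.2 ⟨mem_down h'.1 (by omega) le_rfl, fun hh => h.2 (mem_down hh (by omega) le_rfl)⟩
    have := ih hm
    have := T.col_strict (i + n) j hm (mem_skew.2 h')
    have e : i + (n + 1) = i + n + 1 := by omega
    rw [e]
    omega

theorem entry_lt (T : LRFilling π μ ν) {i j : ℕ} (h : (i, j) ∈ π.cells \ μ.cells) :
    T.entry i j < ν.colLen 0 := by
  rw [← YoungDiagram.mem_iff_lt_colLen, YoungDiagram.mem_iff_lt_rowLen, ← T.content]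
  apply Finset.card_pos.2
  exact ⟨(i, j), Finset.mem_filter.2 ⟨h, rfl⟩⟩

theorem row_zero (T : LRFilling π μ ν) {j : ℕ} (h : (0, j) ∈ π.cells \ μ.cells) :
    T.entry 0 j = 0 := by
  by_contra hne
  obtain ⟨k, hk⟩ := Nat.exists_eq_succ_of_ne_zero hne
  have h1 := T.lattice 0 j k
  have h2 : 0 < ((π.cells \ μ.cells).filter fun c =>
        (c.1 < 0 ∨ (c.1 = 0 ∧ j ≤ c.2)) ∧ T.entry c.1 c.2 = k + 1).card := by
    apply Finset.card_pos.2
    exact ⟨(0, j), Finset.mem_filter.2 ⟨h, by simp, hk⟩⟩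
  obtain ⟨⟨i', j'⟩, hc⟩ := Finset.card_pos.1 (h2.trans_le h1)
  rw [Finset.mem_filter] at hc
  obtain ⟨hc1, hc2, hc3⟩ := hc
  simp only at hc2 hc3
  have hi : i' = 0 := by omega
  subst hi
  have := T.row_mono h hc1 (by omega)
  omega

theorem finite : Finite (LRFilling π μ ν) := by
  let f : LRFilling π μ ν → ((π.cells \ μ.cells : Finset (ℕ × ℕ)) → Fin (ν.colLen 0)) :=
    fun T c => ⟨T.entry c.1.1 c.1.2, T.entry_lt c.2⟩
  apply Finite.of_injective f
  intro T T' h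
  have he : T.entry = T'.entry := by
    funext i j
    by_cases hm : (i, j) ∈ π.cells \ μ.cells
    · have := congrFun h ⟨(i, j), hm⟩
      simpa [f] using this
    · rw [T.zeros i j hm, T'.zeros i j hm]
  cases T
  cases T'
  simpa using he

end LRFilling

theorem lrCoeff_ne_zero {π μ ν : YoungDiagram} :
    lrCoeff π μ ν ≠ 0 ↔ Nonempty (LRFilling π μ ν) := by
  have : Finite (LRFilling π μ ν) := LRFilling.finite
  rw [lrCoeff, Nat.card_ne_zero]
  simp [this]

/-! ### Counting by shifting -/

theorem card_shift_row {A B : Finset (ℕ × ℕ)} (h : ∀ i j, (i, j) ∈ A ↔ (i + 1, j) ∈ B)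
    (h0 : ∀ j, (0, j) ∉ B) : A.card = B.card := by
  apply Finset.card_bij (fun c _ => (c.1 + 1, c.2))
  · rintro ⟨i, j⟩ hc
    exact (h i j).1 hc
  · rintro ⟨i, j⟩ _ ⟨i', j'⟩ _ he
    simpa using he
  · rintro ⟨i, j⟩ hc
    cases i with
    | zero => exact absurd hc (h0 j)
    | succ i => exact ⟨(i, j), (h i j).2 hc, rfl⟩

theorem card_shift_col {A B : Finset (ℕ × ℕ)} (h : ∀ i j, (i, j) ∈ A ↔ (i, j + 1) ∈ B) :
    B.card = A.card + (B.filter fun c => c.2 = 0).card := by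
  rw [← Finset.card_filter_add_card_filter_not (s := B) (fun c => c.2 = 0), add_comm]
  congr 1
  symm
  apply Finset.card_bij (fun c _ => (c.1, c.2 + 1))
  · rintro ⟨i, j⟩ hc
    simpa using (h i j).1 hc
  · rintro ⟨i, j⟩ _ ⟨i', j'⟩ _ he
    simpa using he
  · rintro ⟨i, j⟩ hc
    rw [Finset.mem_filter] at hc
    cases j with
    | zero => exact absurd rfl hc.2
    | succ j => exact ⟨(i, j), (h i j).2 hc.1, rfl⟩

theorem card_row_zero {π μ : YoungDiagram} :
    ((π.cells \ μ.cells).filter fun c => c.1 = 0).card = π.rowLen 0 - μ.rowLen 0 := by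
  rw [← Nat.card_Ico]
  symm
  apply Finset.card_bij (fun j _ => (0, j))
  · intro j hj
    rw [Finset.mem_Ico] at hj
    rw [Finset.mem_filter, mem_skew, YoungDiagram.mem_iff_lt_rowLen,
      YoungDiagram.mem_iff_lt_rowLen]
    simp
    omega
  · intro j _ j' _ he
    simpa using he
  · rintro ⟨i, j⟩ hc
    rw [Finset.mem_filter, mem_skew, YoungDiagram.mem_iff_lt_rowLen,
      YoungDiagram.mem_iff_lt_rowLen] at hc
    obtain ⟨hc, hi⟩ := hc
    simp only at hi
    subst hi
    exact ⟨j, by rw [Finset.mem_Ico]; omega, rfl⟩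

/-! ### Rows -/

theorem LRFilling.row_bound {π μ ν : YoungDiagram} (T : LRFilling π μ ν) :
    π.rowLen 0 ≤ μ.rowLen 0 + ν.rowLen 0 := by
  have h1 : ((π.cells \ μ.cells).filter fun c => c.1 = 0).card ≤ ν.rowLen 0 := by
    rw [← T.content 0]
    apply Finset.card_le_card
    rintro ⟨i, j⟩ hc
    rw [Finset.mem_filter] at hc ⊢
    obtain ⟨hc, hi⟩ := hc
    simp only at hi
    subst hi
    exact ⟨hc, T.row_zero hc⟩
  rw [card_row_zero] at h1
  omega

theorem LRFilling.stripRow_nonempty {π μ ν : YoungDiagram} (T : LRFilling π μ ν)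
    (h : π.rowLen 0 = μ.rowLen 0 + ν.rowLen 0) :
    Nonempty (LRFilling (stripRow π) (stripRow μ) (stripRow ν)) := by
  have hsub : ((π.cells \ μ.cells).filter fun c => c.1 = 0) =
      ((π.cells \ μ.cells).filter fun c => T.entry c.1 c.2 = 0) := by
    apply Finset.eq_of_subset_of_card_le
    · rintro ⟨i, j⟩ hc
      rw [Finset.mem_filter] at hc ⊢
      obtain ⟨hc, hi⟩ := hc
      simp only at hi
      subst hi
      exact ⟨hc, T.row_zero hc⟩
    · rw [T.content 0, card_row_zero]
      omega
  have hpos : ∀ i j, (i + 1, j) ∈ π.cells \ μ.cells → 0 < T.entry (i + 1) j := by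
    intro i j hm
    by_contra h0
    have : (i + 1, j) ∈ ((π.cells \ μ.cells).filter fun c => T.entry c.1 c.2 = 0) :=
      Finset.mem_filter.2 ⟨hm, by simp only; omega⟩
    rw [← hsub, Finset.mem_filter] at this
    simp at this
  have hs : ∀ i j, (i, j) ∈ (stripRow π).cells \ (stripRow μ).cells ↔
      (i + 1, j) ∈ π.cells \ μ.cells := by
    intro i j
    rw [mem_skew, mem_skew, mem_stripRow', mem_stripRow']
  have hlat : ∀ i j k, (((stripRow π).cells \ (stripRow μ).cells).filter fun c =>
        (c.1 < i ∨ (c.1 = i ∧ j ≤ c.2)) ∧ T.entry (c.1 + 1) c.2 - 1 = k).card =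
      ((π.cells \ μ.cells).filter fun c =>
        (c.1 < i + 1 ∨ (c.1 = i + 1 ∧ j ≤ c.2)) ∧ T.entry c.1 c.2 = k + 1).card := by
    intro i j k
    apply card_shift_row
    · intro i' j'
      rw [Finset.mem_filter, Finset.mem_filter, hs]
      constructor
      · rintro ⟨h1, h2, h3⟩
        have := hpos i' j' h1
        simp only at h2 h3
        refine ⟨h1, ?_, ?_⟩ <;> simp only <;> omega
      · rintro ⟨h1, h2, h3⟩
        have := hpos i' j' h1
        simp only at h2 h3
        refine ⟨h1, ?_, ?_⟩ <;> simp only <;> omega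
    · intro j' hc
      rw [Finset.mem_filter] at hc
      have := T.row_zero hc.1
      have := hc.2.2
      simp only at this
      omega
  refine ⟨⟨?_, fun i j => T.entry (i + 1) j - 1, ?_, ?_, ?_, ?_, ?_⟩⟩
  · rw [yd_le]
    intro i j hm
    rw [mem_stripRow'] at hm ⊢
    exact T.le hm
  · intro i j hm
    rw [hs] at hm
    rw [T.zeros _ _ hm]
  · intro i j h1 h2
    rw [hs] at h1 h2
    have := T.row_weak _ _ h1 h2
    omega
  · intro i j h1 h2
    rw [hs] at h1 h2
    have := T.col_strict _ _ h1 h2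
    have := hpos _ _ h1
    omega
  · intro k
    rw [rowLen_stripRow, ← T.content]
    apply card_shift_row
    · intro i' j'
      rw [Finset.mem_filter, Finset.mem_filter, hs]
      constructor
      · rintro ⟨h1, h3⟩
        have := hpos i' j' h1
        simp only at h3
        refine ⟨h1, ?_⟩
        simp only
        omega
      · rintro ⟨h1, h3⟩
        simp only at h3
        refine ⟨h1, ?_⟩
        simp only
        omega
    · intro j' hc
      rw [Finset.mem_filter] at hc
      have := T.row_zero hc.1
      have := hc.2
      simp only at this
      omega
  · intro i j k
    rw [hlat, hlat]
    exact T.lattice _ _ _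

/-- entries of the filling obtained by adding a row of zeros -/
noncomputable def rowEntry (π μ : YoungDiagram) (e : ℕ → ℕ → ℕ) : ℕ → ℕ → ℕ
  | 0, _ => 0
  | i + 1, j => if (i + 1, j) ∈ π.cells \ μ.cells then e i j + 1 else 0

theorem LRFilling.unstripRow {π μ ν : YoungDiagram}
    (T : LRFilling (stripRow π) (stripRow μ) (stripRow ν))
    (h : π.rowLen 0 = μ.rowLen 0 + ν.rowLen 0) : Nonempty (LRFilling π μ ν) := by
  have hs : ∀ i j, (i, j) ∈ (stripRow π).cells \ (stripRow μ).cells ↔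
      (i + 1, j) ∈ π.cells \ μ.cells := by
    intro i j
    rw [mem_skew, mem_skew, mem_stripRow', mem_stripRow']
  have e0 : ∀ j, rowEntry π μ T.entry 0 j = 0 := fun _ => rfl
  have e1 : ∀ i j, (i + 1, j) ∈ π.cells \ μ.cells →
      rowEntry π μ T.entry (i + 1) j = T.entry i j + 1 := by
    intro i j hm
    exact if_pos hm
  have hfull : ∀ k, ((π.cells \ μ.cells).filter fun c =>
      rowEntry π μ T.entry c.1 c.2 = k).card = ν.rowLen k := by
    intro k
    cases k with
    | zero =>
      have : ((π.cells \ μ.cells).filter fun c => rowEntry π μ T.entry c.1 c.2 = 0) =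
          ((π.cells \ μ.cells).filter fun c => c.1 = 0) := by
        apply Finset.filter_congr
        rintro ⟨i, j⟩ hm
        cases i with
        | zero => simp [e0]
        | succ i => simp [e1 i j hm]
      rw [this, card_row_zero]
      omega
    | succ k =>
      rw [← rowLen_stripRow, ← T.content]
      symm
      apply card_shift_row
      · intro i j
        rw [Finset.mem_filter, Finset.mem_filter, hs]
        apply and_congr_right
        intro hm
        simp [e1 i j hm]
      · intro j hc
        rw [Finset.mem_filter] at hc
        simp [e0] at hc
  have hlat : ∀ i j k, ((π.cells \ μ.cells).filter fun c =>
        (c.1 < i + 1 ∨ (c.1 = i + 1 ∧ j ≤ c.2)) ∧ rowEntry π μ T.entry c.1 c.2 = k + 1).card =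
      (((stripRow π).cells \ (stripRow μ).cells).filter fun c =>
        (c.1 < i ∨ (c.1 = i ∧ j ≤ c.2)) ∧ T.entry c.1 c.2 = k).card := by
    intro i j k
    symm
    apply card_shift_row
    · intro i' j'
      rw [Finset.mem_filter, Finset.mem_filter, hs]
      apply and_congr_right
      intro hm
      simp [e1 i' j' hm]
    · intro j hc
      rw [Finset.mem_filter] at hc
      simp [e0] at hc
  refine ⟨⟨?_, rowEntry π μ T.entry, ?_, ?_, ?_, hfull, ?_⟩⟩
  · rw [yd_le]
    intro i j hm
    cases i with
    | zero =>
      rw [YoungDiagram.mem_iff_lt_rowLen] at hm ⊢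
      omega
    | succ i =>
      rw [← mem_stripRow'] at hm ⊢
      exact T.le hm
  · intro i j hm
    cases i with
    | zero => rfl
    | succ i => exact if_neg hm
  · intro i j h1 h2
    cases i with
    | zero => simp [e0]
    | succ i =>
      rw [e1 _ _ h1, e1 _ _ h2]
      rw [← hs] at h1 h2
      have := T.row_weak _ _ h1 h2
      omega
  · intro i j h1 h2
    cases i with
    | zero =>
      rw [e0, e1 _ _ h2]
      omega
    | succ i =>
      rw [e1 _ _ h1, e1 _ _ h2]
      rw [← hs] at h1 h2
      have := T.col_strict _ _ h1 h2
      omega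
  · intro i j k
    cases i with
    | zero =>
      have : ((π.cells \ μ.cells).filter fun c =>
        (c.1 < 0 ∨ (c.1 = 0 ∧ j ≤ c.2)) ∧ rowEntry π μ T.entry c.1 c.2 = k + 1) = ∅ := by
        apply Finset.filter_eq_empty_iff.2
        rintro ⟨i', j'⟩ _ ⟨h2, h3⟩
        simp only at h2 h3
        have hi : i' = 0 := by omega
        subst hi
        simp [e0] at h3
      rw [this]
      simp
    | succ i =>
      cases k with
      | zero =>
        calc _ ≤ ((π.cells \ μ.cells).filter fun c =>
                rowEntry π μ T.entry c.1 c.2 = 1).card := by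
              apply Finset.card_le_card
              intro c hc
              rw [Finset.mem_filter] at hc ⊢
              exact ⟨hc.1, hc.2.2⟩
          _ = ν.rowLen 1 := hfull 1
          _ ≤ ν.rowLen 0 := ν.rowLen_anti 0 1 (by omega)
          _ = _ := by
              rw [← hfull 0]
              congr 1
              apply Finset.filter_congr
              rintro ⟨i', j'⟩ hm
              cases i' with
              | zero => simp [e0]
              | succ i' => simp [e1 i' j' hm]
      | succ k =>
        rw [hlat, hlat]
        exact T.lattice _ _ _

/-! ### Columns -/

theorem LRFilling.col_bound {π μ ν : YoungDiagram} (T : LRFilling π μ ν) :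
    π.colLen 0 ≤ μ.colLen 0 + ν.colLen 0 := by
  by_contra hlt
  push Not at hlt
  have h1 : (μ.colLen 0, 0) ∈ π.cells \ μ.cells := by
    rw [mem_skew, YoungDiagram.mem_iff_lt_colLen, YoungDiagram.mem_iff_lt_colLen]
    omega
  have h2 : (μ.colLen 0 + ν.colLen 0, 0) ∈ π.cells \ μ.cells := by
    rw [mem_skew, YoungDiagram.mem_iff_lt_colLen, YoungDiagram.mem_iff_lt_colLen]
    omega
  have := T.col_mono h1 h2
  have := T.entry_lt h2
  omega

theorem LRFilling.stripCol_nonempty {π μ ν : YoungDiagram} (T : LRFilling π μ ν)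
    (h : π.colLen 0 = μ.colLen 0 + ν.colLen 0) :
    Nonempty (LRFilling (stripCol π) (stripCol μ) (stripCol ν)) := by
  have hcol : ∀ i, (i, 0) ∈ π.cells \ μ.cells ↔
      μ.colLen 0 ≤ i ∧ i < μ.colLen 0 + ν.colLen 0 := by
    intro i
    rw [mem_skew, YoungDiagram.mem_iff_lt_colLen, YoungDiagram.mem_iff_lt_colLen]
    omega
  have hent : ∀ i, (i, 0) ∈ π.cells \ μ.cells → T.entry i 0 + μ.colLen 0 = i := by
    intro i hm
    have hm' := (hcol i).1 hm
    have h1 : (μ.colLen 0, 0) ∈ π.cells \ μ.cells := (hcol _).2 (by omega)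
    have h2 : (μ.colLen 0 + ν.colLen 0 - 1, 0) ∈ π.cells \ μ.cells := (hcol _).2 (by omega)
    have h3 := T.col_mono (d := i - μ.colLen 0) h1 (by convert hm using 2; omega)
    have h4 := T.col_mono (d := μ.colLen 0 + ν.colLen 0 - 1 - i) hm (by convert h2 using 2; omega)
    have h5 := T.entry_lt h2
    rw [show i + (μ.colLen 0 + ν.colLen 0 - 1 - i) = μ.colLen 0 + ν.colLen 0 - 1 by omega] at h4
    rw [show μ.colLen 0 + (i - μ.colLen 0) = i by omega] at h3
    omega
  have hs : ∀ i j, (i, j) ∈ (stripCol π).cells \ (stripCol μ).cells ↔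
      (i, j + 1) ∈ π.cells \ μ.cells := by
    intro i j
    rw [mem_skew, mem_skew, mem_stripCol', mem_stripCol']
  have hlat : ∀ i j k, ((π.cells \ μ.cells).filter fun c =>
        (c.1 < i ∨ (c.1 = i ∧ j + 1 ≤ c.2)) ∧ T.entry c.1 c.2 = k).card =
      (((stripCol π).cells \ (stripCol μ).cells).filter fun c =>
        (c.1 < i ∨ (c.1 = i ∧ j ≤ c.2)) ∧ T.entry c.1 (c.2 + 1) = k).card +
      (if k < ν.colLen 0 ∧ μ.colLen 0 + k < i then 1 else 0) := by
    intro i j k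
    rw [card_shift_col (A := (((stripCol π).cells \ (stripCol μ).cells).filter fun c =>
        (c.1 < i ∨ (c.1 = i ∧ j ≤ c.2)) ∧ T.entry c.1 (c.2 + 1) = k))]
    · congr 1
      split_ifs with hc
      · rw [Finset.card_eq_one]
        refine ⟨(μ.colLen 0 + k, 0), ?_⟩
        ext ⟨i', j'⟩
        simp only [Finset.mem_filter, Finset.mem_singleton, Prod.mk.injEq]
        constructor
        · rintro ⟨⟨h1, h2, h3⟩, rfl⟩
          have := hent _ h1
          omega
        · rintro ⟨rfl, rfl⟩
          have h1 := (hcol (μ.colLen 0 + k)).2 (by omega)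
          have := hent _ h1
          exact ⟨⟨h1, by omega, by omega⟩, rfl⟩
      · rw [Finset.card_eq_zero, Finset.eq_empty_iff_forall_notMem]
        rintro ⟨i', j'⟩ hh
        simp only [Finset.mem_filter] at hh
        obtain ⟨⟨h1, h2, h3⟩, rfl⟩ := hh
        have := hent _ h1
        have := (hcol _).1 h1
        omega
    · intro i' j'
      rw [Finset.mem_filter, Finset.mem_filter, hs]
      simp
  refine ⟨⟨?_, fun i j => T.entry i (j + 1), ?_, ?_, ?_, ?_, ?_⟩⟩
  · rw [yd_le]
    intro i j hm
    rw [mem_stripCol'] at hm ⊢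
    exact T.le hm
  · intro i j hm
    rw [hs] at hm
    rw [T.zeros _ _ hm]
  · intro i j h1 h2
    rw [hs] at h1 h2
    exact T.row_weak _ _ h1 h2
  · intro i j h1 h2
    rw [hs] at h1 h2
    exact T.col_strict _ _ h1 h2
  · intro k
    rw [rowLen_stripCol, ← T.content]
    rw [card_shift_col (A := (((stripCol π).cells \ (stripCol μ).cells).filter fun c =>
        T.entry c.1 (c.2 + 1) = k))
        (B := (π.cells \ μ.cells).filter fun c => T.entry c.1 c.2 = k)]
    · by_cases hk : k < ν.colLen 0
      · have : (((π.cells \ μ.cells).filter fun c => T.entry c.1 c.2 = k).filter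
            fun c => c.2 = 0).card = 1 := by
          rw [Finset.card_eq_one]
          refine ⟨(μ.colLen 0 + k, 0), ?_⟩
          ext ⟨i', j'⟩
          simp only [Finset.mem_filter, Finset.mem_singleton, Prod.mk.injEq]
          constructor
          · rintro ⟨⟨h1, h3⟩, rfl⟩
            have := hent _ h1
            omega
          · rintro ⟨rfl, rfl⟩
            have h1 := (hcol (μ.colLen 0 + k)).2 (by omega)
            have := hent _ h1
            exact ⟨⟨h1, by omega⟩, rfl⟩
        omega
      · have h1 : (((stripCol π).cells \ (stripCol μ).cells).filter fun c =>
            T.entry c.1 (c.2 + 1) = k).card = 0 := by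
          rw [Finset.card_eq_zero, Finset.eq_empty_iff_forall_notMem]
          rintro ⟨i', j'⟩ hh
          rw [Finset.mem_filter, hs] at hh
          have := T.entry_lt hh.1
          have := hh.2
          simp only at this
          omega
        have h2 : (((π.cells \ μ.cells).filter fun c => T.entry c.1 c.2 = k).filter
            fun c => c.2 = 0).card = 0 := by
          rw [Finset.card_eq_zero, Finset.eq_empty_iff_forall_notMem]
          rintro ⟨i', j'⟩ hh
          simp only [Finset.mem_filter] at hh
          have := T.entry_lt hh.1.1
          have := hh.1.2
          omega
        omega
    · intro i' j'
      rw [Finset.mem_filter, Finset.mem_filter, hs]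
  · intro i j k
    have a1 := hlat i j k
    have a2 := hlat i j (k + 1)
    have l1 := T.lattice i (j + 1) k
    by_cases hk : i = μ.colLen 0 + k + 1 ∧ k + 1 < ν.colLen 0
    · obtain ⟨rfl, hk⟩ := hk
      have l2 := T.lattice (μ.colLen 0 + k + 1) 0 k
      have hm := (hcol (μ.colLen 0 + k + 1)).2 (by omega)
      have hme := hent _ hm
      have c1 : ((π.cells \ μ.cells).filter fun c => (c.1 < μ.colLen 0 + k + 1 ∨
            (c.1 = μ.colLen 0 + k + 1 ∧ j + 1 ≤ c.2)) ∧ T.entry c.1 c.2 = k + 1).card <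
          ((π.cells \ μ.cells).filter fun c => (c.1 < μ.colLen 0 + k + 1 ∨
            (c.1 = μ.colLen 0 + k + 1 ∧ 0 ≤ c.2)) ∧ T.entry c.1 c.2 = k + 1).card := by
        apply Finset.card_lt_card
        rw [Finset.ssubset_iff_of_subset]
        · refine ⟨(μ.colLen 0 + k + 1, 0), ?_, ?_⟩
          · rw [Finset.mem_filter]
            exact ⟨hm, by simp, by simp only; omega⟩
          · rw [Finset.mem_filter]
            simp
        · intro c hc
          rw [Finset.mem_filter] at hc ⊢
          exact ⟨hc.1, by omega, hc.2.2⟩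
      have c2 : ((π.cells \ μ.cells).filter fun c => (c.1 < μ.colLen 0 + k + 1 ∨
            (c.1 = μ.colLen 0 + k + 1 ∧ 0 ≤ c.2)) ∧ T.entry c.1 c.2 = k).card ≤
          ((π.cells \ μ.cells).filter fun c => (c.1 < μ.colLen 0 + k + 1 ∨
            (c.1 = μ.colLen 0 + k + 1 ∧ j + 1 ≤ c.2)) ∧ T.entry c.1 c.2 = k).card := by
        apply Finset.card_le_card
        rintro ⟨i', j'⟩ hc
        rw [Finset.mem_filter] at hc ⊢
        obtain ⟨h1, h2, h3⟩ := hc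
        simp only at h2 h3
        refine ⟨h1, ?_, h3⟩
        simp only
        rcases h2 with h2 | ⟨rfl, _⟩
        · exact Or.inl h2
        · have := T.row_mono hm h1 (Nat.zero_le _)
          omega
      split_ifs at a1 a2 <;> omega
    · by_cases hk' : k + 1 < ν.colLen 0
      · split_ifs at a1 a2 <;> omega
      · have : (((stripCol π).cells \ (stripCol μ).cells).filter fun c =>
            (c.1 < i ∨ (c.1 = i ∧ j ≤ c.2)) ∧ T.entry c.1 (c.2 + 1) = k + 1) = ∅ := by
          apply Finset.filter_eq_empty_iff.2
          rintro ⟨i', j'⟩ hm ⟨h2, h3⟩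
          rw [hs] at hm
          have := T.entry_lt hm
          simp only at h3
          omega
        rw [this]
        simp

/-- entries of the filling obtained by adding a column -/
noncomputable def colEntry (π μ : YoungDiagram) (e : ℕ → ℕ → ℕ) (i : ℕ) : ℕ → ℕ
  | 0 => if (i, 0) ∈ π.cells \ μ.cells then i - μ.colLen 0 else 0
  | j + 1 => e i j

theorem LRFilling.unstripCol {π μ ν : YoungDiagram}
    (T : LRFilling (stripCol π) (stripCol μ) (stripCol ν))
    (h : π.colLen 0 = μ.colLen 0 + ν.colLen 0) : Nonempty (LRFilling π μ ν) := by
  have hcol : ∀ i, (i, 0) ∈ π.cells \ μ.cells ↔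
      μ.colLen 0 ≤ i ∧ i < μ.colLen 0 + ν.colLen 0 := by
    intro i
    rw [mem_skew, YoungDiagram.mem_iff_lt_colLen, YoungDiagram.mem_iff_lt_colLen]
    omega
  have hs : ∀ i j, (i, j) ∈ (stripCol π).cells \ (stripCol μ).cells ↔
      (i, j + 1) ∈ π.cells \ μ.cells := by
    intro i j
    rw [mem_skew, mem_skew, mem_stripCol', mem_stripCol']
  have e0 : ∀ i, (i, 0) ∈ π.cells \ μ.cells →
      colEntry π μ T.entry i 0 + μ.colLen 0 = i := by
    intro i hm
    have := (hcol i).1 hm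
    have : colEntry π μ T.entry i 0 = i - μ.colLen 0 := if_pos hm
    omega
  have e1 : ∀ i j, colEntry π μ T.entry i (j + 1) = T.entry i j := fun _ _ => rfl
  have hlat : ∀ (P : ℕ × ℕ → Prop) [DecidablePred P] (k : ℕ), ((π.cells \ μ.cells).filter fun c =>
        P c ∧ colEntry π μ T.entry c.1 c.2 = k).card =
      (((stripCol π).cells \ (stripCol μ).cells).filter fun c =>
        P (c.1, c.2 + 1) ∧ T.entry c.1 c.2 = k).card +
      (if k < ν.colLen 0 ∧ P (μ.colLen 0 + k, 0) then 1 else 0) := by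
    intro P _ k
    rw [card_shift_col (A := (((stripCol π).cells \ (stripCol μ).cells).filter fun c =>
        P (c.1, c.2 + 1) ∧ T.entry c.1 c.2 = k))]
    · congr 1
      split_ifs with hc
      · rw [Finset.card_eq_one]
        refine ⟨(μ.colLen 0 + k, 0), ?_⟩
        ext ⟨i', j'⟩
        simp only [Finset.mem_filter, Finset.mem_singleton, Prod.mk.injEq]
        constructor
        · rintro ⟨⟨h1, h2, h3⟩, rfl⟩
          have := e0 _ h1
          omega
        · rintro ⟨rfl, rfl⟩
          have h1 := (hcol (μ.colLen 0 + k)).2 (by omega)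
          have := e0 _ h1
          exact ⟨⟨h1, hc.2, by omega⟩, rfl⟩
      · rw [Finset.card_eq_zero, Finset.eq_empty_iff_forall_notMem]
        rintro ⟨i', j'⟩ hh
        simp only [Finset.mem_filter] at hh
        obtain ⟨⟨h1, h2, h3⟩, rfl⟩ := hh
        have h4 := e0 _ h1
        have h5 := (hcol _).1 h1
        apply hc
        have : i' = μ.colLen 0 + k := by omega
        subst this
        exact ⟨by omega, h2⟩
    · intro i' j'
      rw [Finset.mem_filter, Finset.mem_filter, hs]
      simp [e1]
  refine ⟨⟨?_, colEntry π μ T.entry, ?_, ?_, ?_, ?_, ?_⟩⟩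
  · rw [yd_le]
    intro i j hm
    cases j with
    | zero =>
      rw [YoungDiagram.mem_iff_lt_colLen] at hm ⊢
      omega
    | succ j =>
      rw [← mem_stripCol'] at hm ⊢
      exact T.le hm
  · intro i j hm
    cases j with
    | zero => exact if_neg hm
    | succ j =>
      rw [e1]
      rw [← hs] at hm
      exact T.zeros _ _ hm
  · intro i j h1 h2
    cases j with
    | zero =>
      have h3 := e0 _ h1
      have h4 := (hcol _).1 h1
      rw [e1]
      rw [← hs] at h2
      have h2' := mem_skew.1 h2
      have h5 : (μ.colLen 0, 0) ∈ (stripCol π).cells \ (stripCol μ).cells := by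
        rw [mem_skew]
        refine ⟨mem_down h2'.1 h4.1 le_rfl, fun hh => ?_⟩
        rw [mem_stripCol'] at hh
        have := mem_down hh le_rfl (Nat.zero_le 1)
        rw [YoungDiagram.mem_iff_lt_colLen] at this
        omega
      have h6 := T.col_mono (d := i - μ.colLen 0) h5 (by convert h2 using 2; omega)
      rw [show μ.colLen 0 + (i - μ.colLen 0) = i by omega] at h6
      omega
    | succ j =>
      rw [e1, e1]
      rw [← hs] at h1 h2
      exact T.row_weak _ _ h1 h2
  · intro i j h1 h2
    cases j with
    | zero =>
      have := e0 _ h1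
      have := e0 _ h2
      omega
    | succ j =>
      rw [e1, e1]
      rw [← hs] at h1 h2
      exact T.col_strict _ _ h1 h2
  · intro k
    have h1 := hlat (fun _ => True) k
    have h2 := T.content k
    rw [rowLen_stripCol] at h2
    simp only [true_and, and_true] at h1
    rw [h1, h2]
    have h3 : k < ν.colLen 0 ↔ 0 < ν.rowLen k := by
      rw [← YoungDiagram.mem_iff_lt_colLen, YoungDiagram.mem_iff_lt_rowLen]
    split_ifs <;> omega
  · intro i j k
    have a1 := hlat (fun c => c.1 < i ∨ (c.1 = i ∧ j ≤ c.2)) k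
    have a2 := hlat (fun c => c.1 < i ∨ (c.1 = i ∧ j ≤ c.2)) (k + 1)
    have hl : ∀ k, (((stripCol π).cells \ (stripCol μ).cells).filter fun c =>
        (c.1 < i ∨ (c.1 = i ∧ j ≤ c.2 + 1)) ∧ T.entry c.1 c.2 = k) =
        (((stripCol π).cells \ (stripCol μ).cells).filter fun c =>
        (c.1 < i ∨ (c.1 = i ∧ j - 1 ≤ c.2)) ∧ T.entry c.1 c.2 = k) := by
      intro k
      apply Finset.filter_congr
      intro c _
      rw [show j ≤ c.2 + 1 ↔ j - 1 ≤ c.2 by omega]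
    simp only [hl] at a1 a2
    have := T.lattice i (j - 1) k
    rw [a1, a2]
    split_ifs <;> omega

/-! ### Adding a row or a column to a diagram -/

theorem exists_addRow (π : YoungDiagram) (n : ℕ) (h : π.rowLen 0 ≤ n) :
    ∃ π' : YoungDiagram, stripRow π' = π ∧ π'.rowLen 0 = n := by
  let C : Finset (ℕ × ℕ) := (Finset.range n).image (fun j => (0, j)) ∪
    π.cells.image (fun c => (c.1 + 1, c.2))
  have h0 : ∀ j, (0, j) ∈ C ↔ j < n := by
    intro j
    simp [C]
  have h1 : ∀ i j, (i + 1, j) ∈ C ↔ (i, j) ∈ π := by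
    intro i j
    simp [C]
  have hlow : IsLowerSet (C : Set (ℕ × ℕ)) := by
    rintro ⟨i, j⟩ ⟨i', j'⟩ ⟨hi, hj⟩ hm
    simp only [Finset.mem_coe] at hm ⊢
    simp only at hi hj
    cases i' with
    | zero =>
      rw [h0]
      cases i with
      | zero =>
        rw [h0] at hm
        omega
      | succ i =>
        rw [h1] at hm
        have := mem_down hm (Nat.zero_le i) hj
        rw [YoungDiagram.mem_iff_lt_rowLen] at this
        omega
    | succ i' =>
      cases i with
      | zero => omega
      | succ i =>
        rw [h1] at hm ⊢
        exact mem_down hm (by omega) hj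
  refine ⟨⟨C, hlow⟩, ?_, ?_⟩
  · apply yd_ext
    intro i j
    rw [mem_stripRow', ← h1]
    rfl
  · apply eq_of_forall_lt_iff
    intro c
    rw [← YoungDiagram.mem_iff_lt_rowLen, ← h0]
    rfl

theorem exists_addCol (π : YoungDiagram) (n : ℕ) (h : π.colLen 0 ≤ n) :
    ∃ π' : YoungDiagram, stripCol π' = π ∧ π'.colLen 0 = n := by
  obtain ⟨ρ, h1, h2⟩ := exists_addRow π.transpose n (by rwa [YoungDiagram.rowLen_transpose])
  refine ⟨ρ.transpose, ?_, ?_⟩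
  · simp [stripCol, h1]
  · rwa [YoungDiagram.colLen_transpose]

/-! ### Complements and strips -/

theorem asc_iff {a b : ℕ} {lam : YoungDiagram} : AlmostSelfCompl a b lam ↔ lam ≤ rect a b ∧
    ∀ i j, ((i, j) ∈ lam ↔ (i, j) ∈ rectCompl a b lam) ↔
      ¬ (i = (a - 1) / 2 ∧ j = (b - 1) / 2) := by
  unfold AlmostSelfCompl
  apply and_congr_right
  intro _
  rw [Finset.ext_iff]
  simp only [Finset.mem_union, Finset.mem_sdiff, YoungDiagram.mem_cells, Finset.mem_singleton,
    Prod.forall, Prod.mk.injEq]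
  apply forall_congr'
  intro i
  apply forall_congr'
  intro j
  tauto

theorem rectCompl_le (a b : ℕ) (μ : YoungDiagram) : rectCompl a b μ ≤ rect a b := by
  rw [yd_le]
  intro i j h
  rw [mem_rectCompl'] at h
  exact mem_rect'.2 h.1

theorem rowLen_le_of_le {a b : ℕ} {μ : YoungDiagram} (h : μ ≤ rect a b) : μ.rowLen 0 ≤ b := by
  by_contra hlt
  push Not at hlt
  rw [← YoungDiagram.mem_iff_lt_rowLen] at hlt
  have := mem_rect'.1 (h hlt)
  omega

theorem colLen_le_of_le {a b : ℕ} {μ : YoungDiagram} (h : μ ≤ rect a b) : μ.colLen 0 ≤ a := by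
  by_contra hlt
  push Not at hlt
  rw [← YoungDiagram.mem_iff_lt_colLen] at hlt
  have := mem_rect'.1 (h hlt)
  omega

/-- The two corner conditions under which a row is stripped. -/
def RowOK (a b : ℕ) (μ : YoungDiagram) : Prop := (0, b - 1) ∈ μ ∧ (a - 1, 0) ∉ μ

/-- The two corner conditions under which a column is stripped. -/
def ColOK (a b : ℕ) (μ : YoungDiagram) : Prop := (a - 1, 0) ∈ μ ∧ (0, b - 1) ∉ μ

theorem rowOK_compl {a b : ℕ} {μ : YoungDiagram} (ha : 0 < a) (hb : 0 < b) (h : RowOK a b μ) :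
    RowOK a b (rectCompl a b μ) := by
  unfold RowOK at *
  rw [mem_rectCompl', mem_rectCompl']
  simp only [Nat.sub_zero, Nat.sub_self]
  refine ⟨⟨by omega, h.2⟩, fun hh => hh.2 h.1⟩

theorem colOK_compl {a b : ℕ} {μ : YoungDiagram} (ha : 0 < a) (hb : 0 < b) (h : ColOK a b μ) :
    ColOK a b (rectCompl a b μ) := by
  unfold ColOK at *
  rw [mem_rectCompl', mem_rectCompl']
  simp only [Nat.sub_zero, Nat.sub_self]
  refine ⟨⟨by omega, h.2⟩, fun hh => hh.2 h.1⟩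

theorem rowOK_rowLen {a b : ℕ} {μ : YoungDiagram} (hb : 0 < b) (hle : μ ≤ rect a b)
    (h : RowOK a b μ) : μ.rowLen 0 = b := by
  have h1 := rowLen_le_of_le hle
  have h2 := h.1
  rw [YoungDiagram.mem_iff_lt_rowLen] at h2
  omega

theorem colOK_colLen {a b : ℕ} {μ : YoungDiagram} (ha : 0 < a) (hle : μ ≤ rect a b)
    (h : ColOK a b μ) : μ.colLen 0 = a := by
  have h1 := colLen_le_of_le hle
  have h2 := h.1
  rw [YoungDiagram.mem_iff_lt_colLen] at h2
  omega

theorem rowOK_of_len {a b : ℕ} {μ : YoungDiagram} (hb : 0 < b)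
    (h1 : μ.rowLen 0 = b) (h2 : (rectCompl a b μ).rowLen 0 = b) : RowOK a b μ := by
  refine ⟨YoungDiagram.mem_iff_lt_rowLen.2 (by omega), ?_⟩
  have : (0, b - 1) ∈ rectCompl a b μ := YoungDiagram.mem_iff_lt_rowLen.2 (by omega)
  rw [mem_rectCompl'] at this
  simpa using this.2

theorem colOK_of_len {a b : ℕ} {μ : YoungDiagram} (ha : 0 < a)
    (h1 : μ.colLen 0 = a) (h2 : (rectCompl a b μ).colLen 0 = a) : ColOK a b μ := by
  refine ⟨YoungDiagram.mem_iff_lt_colLen.2 (by omega), ?_⟩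
  have : (a - 1, 0) ∈ rectCompl a b μ := YoungDiagram.mem_iff_lt_colLen.2 (by omega)
  rw [mem_rectCompl'] at this
  simpa using this.2

theorem stripRow_compl {a b : ℕ} {μ : YoungDiagram} (h : RowOK (a + 2) b μ) :
    stripRow (rectCompl (a + 2) b μ) = rectCompl a b (stripRow μ) := by
  apply yd_ext
  intro i j
  rw [mem_stripRow', mem_rectCompl', mem_rectCompl', mem_stripRow']
  by_cases hi : i < a
  · have : a + 2 - 1 - (i + 1) = a - 1 - i + 1 := by omega
    rw [this]
    apply and_congr_left
    intro _
    omega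
  · constructor
    · rintro ⟨h1, h2⟩
      refine absurd (mem_down h.1 (by omega) (by omega)) h2
    · rintro ⟨h1, h2⟩
      omega

theorem stripCol_compl {a b : ℕ} {μ : YoungDiagram} (h : ColOK a (b + 2) μ) :
    stripCol (rectCompl a (b + 2) μ) = rectCompl a b (stripCol μ) := by
  apply yd_ext
  intro i j
  rw [mem_stripCol', mem_rectCompl', mem_rectCompl', mem_stripCol']
  by_cases hj : j < b
  · have : b + 2 - 1 - (j + 1) = b - 1 - j + 1 := by omega
    rw [this]
    apply and_congr_left
    intro _
    omega
  · constructor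
    · rintro ⟨h1, h2⟩
      refine absurd (mem_down h.1 (by omega) (by omega)) h2
    · rintro ⟨h1, h2⟩
      omega

theorem stripRow_le {a b : ℕ} {μ : YoungDiagram} (hle : μ ≤ rect (a + 2) b)
    (h : RowOK (a + 2) b μ) : stripRow μ ≤ rect a b := by
  rw [yd_le]
  intro i j hm
  rw [mem_stripRow'] at hm
  have h1 := mem_rect'.1 (hle hm)
  rw [mem_rect']
  refine ⟨?_, h1.2⟩
  by_contra hi
  exact h.2 (mem_down hm (by omega) (Nat.zero_le _))

theorem stripCol_le {a b : ℕ} {μ : YoungDiagram} (hle : μ ≤ rect a (b + 2))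
    (h : ColOK a (b + 2) μ) : stripCol μ ≤ rect a b := by
  rw [yd_le]
  intro i j hm
  rw [mem_stripCol'] at hm
  have h1 := mem_rect'.1 (hle hm)
  rw [mem_rect']
  refine ⟨h1.1, ?_⟩
  by_contra hi
  exact h.2 (mem_down hm (Nat.zero_le _) (by omega))

theorem stripRow_inj {μ ν : YoungDiagram} (h0 : μ.rowLen 0 = ν.rowLen 0)
    (h : stripRow μ = stripRow ν) : μ = ν := by
  apply yd_ext
  intro i j
  cases i with
  | zero => rw [YoungDiagram.mem_iff_lt_rowLen, YoungDiagram.mem_iff_lt_rowLen, h0]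
  | succ i => rw [← mem_stripRow', ← mem_stripRow', h]

theorem stripCol_inj {μ ν : YoungDiagram} (h0 : μ.colLen 0 = ν.colLen 0)
    (h : stripCol μ = stripCol ν) : μ = ν := by
  apply yd_ext
  intro i j
  cases j with
  | zero => rw [YoungDiagram.mem_iff_lt_colLen, YoungDiagram.mem_iff_lt_colLen, h0]
  | succ j => rw [← mem_stripCol', ← mem_stripCol', h]

theorem asc_stripRow {a b : ℕ} (ha : Odd a) {lam : YoungDiagram}
    (hl : AlmostSelfCompl (a + 2) b lam) (h : RowOK (a + 2) b lam) :
    AlmostSelfCompl a b (stripRow lam) := by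
  rw [asc_iff] at hl ⊢
  refine ⟨stripRow_le hl.1 h, fun i j => ?_⟩
  rw [← stripRow_compl h, mem_stripRow', mem_stripRow', hl.2]
  obtain ⟨k, rfl⟩ := ha
  omega

theorem asc_stripCol {a b : ℕ} (hb : Odd b) {lam : YoungDiagram}
    (hl : AlmostSelfCompl a (b + 2) lam) (h : ColOK a (b + 2) lam) :
    AlmostSelfCompl a b (stripCol lam) := by
  rw [asc_iff] at hl ⊢
  refine ⟨stripCol_le hl.1 h, fun i j => ?_⟩
  rw [← stripCol_compl h, mem_stripCol', mem_stripCol', hl.2]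
  obtain ⟨k, rfl⟩ := hb
  omega

/-! ### The induction -/

/-- existence of a witness -/
def HasWitness (a b : ℕ) (lam : YoungDiagram) : Prop :=
  ∃ π : YoungDiagram, ∀ μ : YoungDiagram, μ ≤ rect a b →
      (Nonempty (LRFilling π μ (rectCompl a b μ)) ↔ μ = lam ∨ μ = rectCompl a b lam)

theorem row_step {a b : ℕ} (hb : 0 < b) {lam : YoungDiagram}
    (hle : lam ≤ rect (a + 2) b) (h : RowOK (a + 2) b lam) (hw : HasWitness a b (stripRow lam)) :
    HasWitness (a + 2) b lam := by
  obtain ⟨ρ, hρ⟩ := hw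
  have hρ0 : ρ.rowLen 0 ≤ 2 * b := by
    obtain ⟨T⟩ := (hρ _ (stripRow_le hle h)).2 (Or.inl rfl)
    have := T.row_bound
    have := rowLen_le_of_le (stripRow_le hle h)
    have := rowLen_le_of_le (rectCompl_le a b (stripRow lam))
    omega
  obtain ⟨π, rfl, hπ0⟩ := exists_addRow ρ (2 * b) hρ0
  have hc := rowOK_compl (by omega) hb h
  have hcle := rectCompl_le (a + 2) b lam
  refine ⟨π, fun μ hμ => ⟨?_, fun hor => ?_⟩⟩
  · rintro ⟨T⟩
    have b1 := T.row_bound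
    have b2 := rowLen_le_of_le hμ
    have b3 := rowLen_le_of_le (rectCompl_le (a + 2) b μ)
    have hOK : RowOK (a + 2) b μ := rowOK_of_len hb (by omega) (by omega)
    have hn := T.stripRow_nonempty (by omega)
    rw [stripRow_compl hOK, hρ _ (stripRow_le hμ hOK), ← stripRow_compl h] at hn
    rcases hn with hn | hn
    · exact Or.inl (stripRow_inj (by rw [rowOK_rowLen hb hμ hOK, rowOK_rowLen hb hle h]) hn)
    · exact Or.inr (stripRow_inj (by rw [rowOK_rowLen hb hμ hOK, rowOK_rowLen hb hcle hc]) hn)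
  · have hOK : RowOK (a + 2) b μ := by
      rcases hor with rfl | rfl
      · exact h
      · exact hc
    have hn : Nonempty (LRFilling (stripRow π) (stripRow μ)
        (stripRow (rectCompl (a + 2) b μ))) := by
      rw [stripRow_compl hOK, hρ _ (stripRow_le hμ hOK), ← stripRow_compl h]
      rcases hor with rfl | rfl
      · exact Or.inl rfl
      · exact Or.inr rfl
    obtain ⟨T⟩ := hn
    apply T.unstripRow
    rw [rowOK_rowLen hb hμ hOK, rowOK_rowLen hb (rectCompl_le (a + 2) b μ)
      (rowOK_compl (by omega) hb hOK)]
    omega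

theorem col_step {a b : ℕ} (ha : 0 < a) {lam : YoungDiagram}
    (hle : lam ≤ rect a (b + 2)) (h : ColOK a (b + 2) lam) (hw : HasWitness a b (stripCol lam)) :
    HasWitness a (b + 2) lam := by
  obtain ⟨ρ, hρ⟩ := hw
  have hρ0 : ρ.colLen 0 ≤ 2 * a := by
    obtain ⟨T⟩ := (hρ _ (stripCol_le hle h)).2 (Or.inl rfl)
    have := T.col_bound
    have := colLen_le_of_le (stripCol_le hle h)
    have := colLen_le_of_le (rectCompl_le a b (stripCol lam))
    omega
  obtain ⟨π, rfl, hπ0⟩ := exists_addCol ρ (2 * a) hρ0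
  have hc := colOK_compl ha (by omega) h
  have hcle := rectCompl_le a (b + 2) lam
  refine ⟨π, fun μ hμ => ⟨?_, fun hor => ?_⟩⟩
  · rintro ⟨T⟩
    have b1 := T.col_bound
    have b2 := colLen_le_of_le hμ
    have b3 := colLen_le_of_le (rectCompl_le a (b + 2) μ)
    have hOK : ColOK a (b + 2) μ := colOK_of_len ha (by omega) (by omega)
    have hn := T.stripCol_nonempty (by omega)
    rw [stripCol_compl hOK, hρ _ (stripCol_le hμ hOK), ← stripCol_compl h] at hn
    rcases hn with hn | hn
    · exact Or.inl (stripCol_inj (by rw [colOK_colLen ha hμ hOK, colOK_colLen ha hle h]) hn)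
    · exact Or.inr (stripCol_inj (by rw [colOK_colLen ha hμ hOK, colOK_colLen ha hcle hc]) hn)
  · have hOK : ColOK a (b + 2) μ := by
      rcases hor with rfl | rfl
      · exact h
      · exact hc
    have hn : Nonempty (LRFilling (stripCol π) (stripCol μ)
        (stripCol (rectCompl a (b + 2) μ))) := by
      rw [stripCol_compl hOK, hρ _ (stripCol_le hμ hOK), ← stripCol_compl h]
      rcases hor with rfl | rfl
      · exact Or.inl rfl
      · exact Or.inr rfl
    obtain ⟨T⟩ := hn
    apply T.unstripCol
    rw [colOK_colLen ha hμ hOK, colOK_colLen ha (rectCompl_le a (b + 2) μ)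
      (colOK_compl ha (by omega) hOK)]
    omega

theorem stripRow_one {μ : YoungDiagram} (h : μ ≤ rect 1 1) : stripRow μ = ⊥ := by
  apply yd_ext
  intro i j
  rw [mem_stripRow']
  constructor
  · intro hm
    have := mem_rect'.1 (h hm)
    omega
  · intro hm
    exact absurd hm (YoungDiagram.notMem_bot _)

theorem base_step (lam : YoungDiagram) (h : AlmostSelfCompl 1 1 lam) : HasWitness 1 1 lam := by
  have hle := h.1
  have key : ∀ μ ν : YoungDiagram, μ ≤ rect 1 1 → ν ≤ rect 1 1 →
      ((0, 0) ∈ μ ↔ (0, 0) ∈ ν) → μ = ν := by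
    intro μ ν h1 h2 h3
    apply yd_ext
    intro i j
    by_cases hij : i = 0 ∧ j = 0
    · obtain ⟨rfl, rfl⟩ := hij
      exact h3
    · constructor
      · intro hm
        have := mem_rect'.1 (h1 hm)
        omega
      · intro hm
        have := mem_rect'.1 (h2 hm)
        omega
  have hcm : ∀ μ, (0, 0) ∈ rectCompl 1 1 μ ↔ (0, 0) ∉ μ := by
    intro μ
    rw [mem_rectCompl']
    simp
  have hlen : ∀ μ : YoungDiagram, (0, 0) ∈ μ ↔ 0 < μ.rowLen 0 := by
    intro μ
    rw [YoungDiagram.mem_iff_lt_rowLen]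
  refine ⟨rect 1 1, fun μ hμ => ⟨fun _ => ?_, fun _ => ?_⟩⟩
  · by_cases hm : ((0, 0) ∈ μ ↔ (0, 0) ∈ lam)
    · exact Or.inl (key _ _ hμ hle hm)
    · refine Or.inr (key _ _ hμ (rectCompl_le 1 1 lam) ?_)
      rw [hcm]
      tauto
  · have hT : LRFilling (⊥ : YoungDiagram) ⊥ ⊥ := by
      refine ⟨le_rfl, fun _ _ => 0, ?_, ?_, ?_, ?_, ?_⟩ <;> intros <;> simp_all
      symm
      by_contra hne
      have := Nat.pos_of_ne_zero hne
      rw [← YoungDiagram.mem_iff_lt_rowLen] at this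
      exact absurd this (YoungDiagram.notMem_bot _)
    have hc := rectCompl_le 1 1 μ
    have hT' : LRFilling (stripRow (rect 1 1)) (stripRow μ) (stripRow (rectCompl 1 1 μ)) := by
      rw [stripRow_one le_rfl, stripRow_one hμ, stripRow_one hc]
      exact hT
    apply hT'.unstripRow
    have l1 := rowLen_le_of_le hμ
    have l2 := rowLen_le_of_le hc
    have l3 := rowLen_le_of_le (le_refl (rect 1 1))
    have m1 : (0, 0) ∈ rect 1 1 := mem_rect'.2 (by omega)
    rw [hlen] at m1
    have m2 := hcm μ
    rw [hlen, hlen] at m2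
    omega

theorem main_induction : ∀ (n a b : ℕ), a + b = n → Odd a → Odd b → ∀ lam : YoungDiagram,
    AlmostSelfCompl a b lam → HasWitness a b lam := by
  intro n
  induction n using Nat.strong_induction_on with
  | _ n ih =>
  intro a b hn ha hb lam hl
  have ha0 := ha.pos
  have hb0 := hb.pos
  have hle := hl.1
  by_cases h11 : a = 1 ∧ b = 1
  · obtain ⟨rfl, rfl⟩ := h11
    exact base_step lam hl
  have hcorner := ((asc_iff.1 hl).2 0 (b - 1)).2 (by
    obtain ⟨k, rfl⟩ := ha
    obtain ⟨l, rfl⟩ := hb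
    omega)
  rw [mem_rectCompl'] at hcorner
  simp only [Nat.sub_zero, Nat.sub_self] at hcorner
  by_cases hc : (0, b - 1) ∈ lam
  · have hOK : RowOK a b lam := ⟨hc, (hcorner.1 hc).2⟩
    have ha1 : a ≠ 1 := by
      rintro rfl
      exact hOK.2 (mem_down hc le_rfl (Nat.zero_le _))
    obtain ⟨a', rfl⟩ : ∃ a', a = a' + 2 := ⟨a - 2, by omega⟩
    have ha' : Odd a' := by
      obtain ⟨k, hk⟩ := ha
      exact ⟨k - 1, by omega⟩
    exact row_step hb0 hle hOK (ih (a' + b) (by omega) a' b rfl ha' hb _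
      (asc_stripRow ha' hl hOK))
  · have hOK : ColOK a b lam := by
      refine ⟨?_, hc⟩
      by_contra hh
      exact hc (hcorner.2 ⟨by omega, hh⟩)
    have hb1 : b ≠ 1 := by
      rintro rfl
      exact hOK.2 (mem_down hOK.1 (Nat.zero_le _) le_rfl)
    obtain ⟨b', rfl⟩ : ∃ b', b = b' + 2 := ⟨b - 2, by omega⟩
    have hb' : Odd b' := by
      obtain ⟨k, hk⟩ := hb
      exact ⟨k - 1, by omega⟩
    exact col_step ha0 hle hOK (ih (a + b') (by omega) a b' rfl ha hb' _
      (asc_stripCol hb' hl hOK))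

/-- For `a`, `b` odd and `lam` almost self-complementary in the `a × b`
rectangle `R`, there is a witness `π`: a partition such that for all `μ ⊆ R`, the
Littlewood–Richardson coefficient `c^π_{μ, μᶜ}` is nonzero iff `μ = lam` or `μ = lamᶜ`. -/
theorem statement15 (a b : ℕ) (ha : Odd a) (hb : Odd b) (lam : YoungDiagram)
    (hlam : AlmostSelfCompl a b lam) :
    ∃ π : YoungDiagram, ∀ μ : YoungDiagram, μ ≤ rect a b →
      (lrCoeff π μ (rectCompl a b μ) ≠ 0 ↔ μ = lam ∨ μ = rectCompl a b lam) := by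
  obtain ⟨π, hπ⟩ := main_induction _ a b rfl ha hb lam hlam
  exact ⟨π, fun μ hμ => lrCoeff_ne_zero.trans (hπ μ hμ)⟩
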